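/- arXiv:2106.08864 — 6 statements merged into one kernel-verified Lean document; each statement's English description precedes it below -/
import Mathlib

section
/- π · ∫_X (∑_{y : Fin K} (r y x / r y_s x) · L x y) dν(x) = ∫_X (∑_{y : Fin K} r y x · L x y) dμ(x). That is, the multi-class classification risk R = E_{p(x,y)}[ℓ(g(x),y)] is recovered as the class prior π times the expectation, over the single-class conditional distribution p(x | y_s), of the confidence-ratio-weighted loss ∑_y (p(y|x)/p(y_s|x)) · ℓ(g(x), y). -/
open MeasureTheory

/-- **SC-Conf risk rewriting (Theorem 1).**
The multi-class classification risk `∫ ∑ y, p(y|x) ℓ(g(x),y) dp(x)` is recovered as the class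
prior `π` times the expectation, over the single-class conditional distribution `p(x|y_s)`, of
the confidence-ratio-weighted loss `∑ y, (p(y|x)/p(y_s|x)) ℓ(g(x),y)`. -/
theorem sc_conf_unbiased_risk
    {X : Type*} [MeasurableSpace X] (μ : Measure X) [IsProbabilityMeasure μ]
    {K : ℕ} (hK : 2 ≤ K) (r : Fin K → X → ℝ)
    (hrm : ∀ y, Measurable (r y)) (hr0 : ∀ y x, 0 ≤ r y x)
    (hr1 : ∀ x, ∑ y, r y x = 1)
    (ys : Fin K) (hys : ∀ᵐ x ∂μ, 0 < r ys x)
    (π : ℝ) (hπ : π = ∫ x, r ys x ∂μ) (hπ0 : 0 < π)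
    (ν : Measure X)
    (hν : ν = (ENNReal.ofReal π)⁻¹ • μ.withDensity fun x => ENNReal.ofReal (r ys x))
    (L : X → Fin K → ℝ) (hLm : ∀ y, Measurable fun x => L x y)
    (hL0 : ∀ x y, 0 ≤ L x y)
    (hint : Integrable (fun x => ∑ y, r y x * L x y) μ) :
    π * ∫ x, ∑ y, r y x / r ys x * L x y ∂ν = ∫ x, ∑ y, r y x * L x y ∂μ := by
  rw [hν, integral_smul_measure, ENNReal.toReal_inv, ENNReal.toReal_ofReal hπ0.le, smul_eq_mul,
    mul_inv_cancel_left₀ hπ0.ne',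
    integral_withDensity_eq_integral_toReal_smul (hrm ys).ennreal_ofReal
      (Filter.Eventually.of_forall fun _ => ENNReal.ofReal_lt_top)]
  refine integral_congr_ae ?_
  filter_upwards [hys] with x hx
  rw [ENNReal.toReal_ofReal hx.le, smul_eq_mul, Finset.mul_sum]
  refine Finset.sum_congr rfl fun y _ => ?_
  rw [← mul_assoc, mul_div_cancel₀ _ hx.ne']
end

section
/- ∫_X φ(x) · (∑_{y : Fin K} r̃ y x · L x y) dν(x) = ∫_X (∑_{y : Fin K} r̃ y x · L x y) dμ(x). That is, the reweighted single-class risk R̃(g) = E_{p(x|y_s)}[φ(x) ∑_y p̃(y|x) ℓ(g(x),y)] equals the expected loss under the noisy joint density p̃(x,y) = p̃(y|x) p(x). -/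
open MeasureTheory

/-- **Noise-robust reweighted risk rewriting.**
The reweighted single-class risk `E_{p(x|y_s)}[φ(x) ∑ y, p̃(y|x) ℓ(g(x),y)]`, with density ratio
`φ(x) = p(x)/p(x|y_s) = π / p(y_s|x)`, equals the expected loss under the noisy joint density
`p̃(x,y) = p̃(y|x) p(x)`. -/
theorem noise_robust_risk_rewriting
    {X : Type*} [MeasurableSpace X] (μ : Measure X) [IsProbabilityMeasure μ]
    {K : ℕ} (hK : 2 ≤ K) (r : Fin K → X → ℝ)
    (hrm : ∀ y, Measurable (r y)) (hr0 : ∀ y x, 0 ≤ r y x)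
    (hr1 : ∀ x, ∑ y, r y x = 1)
    (ys : Fin K) (hys : ∀ᵐ x ∂μ, 0 < r ys x)
    (π : ℝ) (hπ : π = ∫ x, r ys x ∂μ) (hπ0 : 0 < π)
    (ν : Measure X)
    (hν : ν = (ENNReal.ofReal π)⁻¹ • μ.withDensity fun x => ENNReal.ofReal (r ys x))
    (rt : Fin K → X → ℝ)
    (hrtm : ∀ y, Measurable (rt y)) (hrt0 : ∀ y x, 0 ≤ rt y x)
    (hrt1 : ∀ x, ∑ y, rt y x = 1)
    (L : X → Fin K → ℝ) (hLm : ∀ y, Measurable fun x => L x y)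
    (hL0 : ∀ x y, 0 ≤ L x y)
    (hint : Integrable (fun x => ∑ y, rt y x * L x y) μ) :
    ∫ x, (π / r ys x) * ∑ y, rt y x * L x y ∂ν = ∫ x, ∑ y, rt y x * L x y ∂μ := by
  rw [hν, integral_smul_measure,
    integral_withDensity_eq_integral_toReal_smul (hrm ys).ennreal_ofReal
      (.of_forall fun _ => ENNReal.ofReal_lt_top),
    ← integral_smul]
  refine integral_congr_ae ?_
  filter_upwards [hys] with x hx
  rw [ENNReal.toReal_inv, ENNReal.toReal_ofReal hπ0.le, ENNReal.toReal_ofReal hx.le,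
    smul_eq_mul, smul_eq_mul]
  field_simp
end

section
/- Let q and q̃ be two class-posteriors as in the context. Assume that for μ-a.e. x there exists y*(x) : Fin K such that q̃ x (y*(x)) > q̃ x y for every y ≠ y*(x) (the noisy posterior has a unique maximizer at x) and q x (y*(x)) = max_y q x y (this maximizer is also a maximizer of the true posterior). Then every measurable classifier f : X → Fin K satisfying q̃ x (f x) = max_y q̃ x y for μ-a.e. x (i.e., f is Bayes-optimal for the noisy posterior) satisfies R01_q(f) = R01*_q, i.e., f attains the Bayes 0-1 risk of the true posterior. (Classifier-consistency of the noise-robust method, Theorem 3 in 0-1 loss form.) -/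
open MeasureTheory

/-- **Classifier-consistency of the noise-robust method (Theorem 3, 0-1 loss form).**
If for a.e. `x` the noisy posterior `q̃` has a unique maximizer which also maximizes the true
posterior `q`, then any measurable classifier that is Bayes-optimal for the noisy posterior
attains the Bayes 0-1 risk of the true posterior. -/
theorem noisy_bayes_optimal_is_consistent
    {X : Type*} [MeasurableSpace X] (μ : Measure X) [IsProbabilityMeasure μ]
    {K : ℕ} (hK : 2 ≤ K)
    (q qt : X → Fin K → ℝ)
    (hqm : ∀ y, Measurable fun x => q x y) (hq0 : ∀ x y, 0 ≤ q x y)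
    (hq1 : ∀ x, ∑ y, q x y = 1)
    (hqtm : ∀ y, Measurable fun x => qt x y) (hqt0 : ∀ x y, 0 ≤ qt x y)
    (hqt1 : ∀ x, ∑ y, qt x y = 1)
    (hstar : ∀ᵐ x ∂μ, ∃ ystar : Fin K,
      (∀ y, y ≠ ystar → qt x y < qt x ystar) ∧ q x ystar = ⨆ y, q x y)
    (f : X → Fin K) (hf : Measurable f)
    (hbayes : ∀ᵐ x ∂μ, qt x (f x) = ⨆ y, qt x y) :
    ∫ x, (1 - q x (f x)) ∂μ = ∫ x, (1 - ⨆ y, q x y) ∂μ := by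
  refine integral_congr_ae ?_
  filter_upwards [hstar, hbayes] with x ⟨ystar, huniq, hmax⟩ hfx
  have hf_eq : f x = ystar := by
    by_contra hne
    have hle : qt x ystar ≤ ⨆ y, qt x y := le_ciSup (Set.finite_range (qt x)).bddAbove ystar
    exact absurd (huniq (f x) hne) (not_lt.mpr (hfx ▸ hle))
  rw [hf_eq, hmax]
end

section
/- Suppose there exist ε > 0 and a measurable map y* : X → Fin K such that for μ-a.e. x, q x (y*(x)) ≥ q x y + ε for every y ≠ y*(x) (the gap between the largest and second-largest posterior probability is at least ε everywhere). Then for every measurable classifier f : X → Fin K, μ{ x : f x ≠ y*(x) } ≤ (R01_q(f) − R01*_q) / ε. -/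
open MeasureTheory

/-- Evaluating a family of measurable functions along a measurable choice of index in a countable
discrete space gives a measurable function. -/
lemma measurable_eval_of_countable {X Y Z : Type*} [MeasurableSpace X] [MeasurableSpace Y]
    [MeasurableSpace Z] [Countable Y] [MeasurableSingletonClass Y] {q : X → Y → Z}
    (hq : ∀ y, Measurable fun x => q x y) {g : X → Y} (hg : Measurable g) :
    Measurable fun x => q x (g x) :=
  (measurable_from_prod_countable_right (f := fun p : Y × X => q p.2 p.1) hq).comp
    (hg.prodMk measurable_id)

/-- **Margin bound on the disagreement probability.**
If the true posterior `q` has a uniform margin `ε > 0` between the largest class-posterior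
(attained by the measurable map `y*`) and all the other classes, then for every measurable
classifier `f`, the probability that `f` disagrees with `y*` is at most the excess 0-1 risk
divided by `ε`. -/
theorem margin_bound_disagreement
    {X : Type*} [MeasurableSpace X] (μ : Measure X) [IsProbabilityMeasure μ]
    {K : ℕ} (hK : 2 ≤ K)
    (q : X → Fin K → ℝ)
    (hqm : ∀ y, Measurable fun x => q x y) (hq0 : ∀ x y, 0 ≤ q x y)
    (hq1 : ∀ x, ∑ y, q x y = 1)
    (ε : ℝ) (hε : 0 < ε)
    (ystar : X → Fin K) (hystar : Measurable ystar)
    (hgap : ∀ᵐ x ∂μ, ∀ y, y ≠ ystar x → q x y + ε ≤ q x (ystar x))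
    (f : X → Fin K) (hf : Measurable f) :
    (μ {x | f x ≠ ystar x}).toReal ≤
      ((∫ x, (1 - q x (f x)) ∂μ) - (∫ x, (1 - ⨆ y, q x y) ∂μ)) / ε := by
  have hqle (x : X) (y : Fin K) : q x y ≤ 1 :=
    (hq1 x).symm ▸ Finset.single_le_sum (fun i _ => hq0 x i) (Finset.mem_univ y)
  have hint (g : X → Fin K) (hg : Measurable g) : Integrable (fun x => 1 - q x (g x)) μ := by
    refine Integrable.of_bound
      (measurable_const.sub (measurable_eval_of_countable hqm hg)).aestronglyMeasurable 1
      (.of_forall fun x => ?_)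
    rw [Real.norm_eq_abs, abs_le]
    constructor <;> linarith [hq0 x (g x), hqle x (g x)]
  have hsup : ∫ x, (1 - ⨆ y, q x y) ∂μ = ∫ x, (1 - q x (ystar x)) ∂μ := by
    refine integral_congr_ae ?_
    filter_upwards [hgap] with x hx
    have : Nonempty (Fin K) := ⟨ystar x⟩
    congr 1
    refine le_antisymm (ciSup_le fun y => ?_) (le_ciSup (Set.finite_range (q x)).bddAbove _)
    rcases eq_or_ne y (ystar x) with rfl | hy
    · exact le_rfl
    · linarith [hx y hy]
  have hmeas : MeasurableSet {x | f x ≠ ystar x} := (measurableSet_eq_fun hf hystar).compl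
  rw [hsup, ← integral_sub (hint f hf) (hint ystar hystar), le_div_iff₀ hε]
  calc (μ {x | f x ≠ ystar x}).toReal * ε
      = ∫ x, {x | f x ≠ ystar x}.indicator (fun _ => ε) x ∂μ := by
        rw [integral_indicator_const ε hmeas, smul_eq_mul, Measure.real]
    _ ≤ _ := by
        refine integral_mono_ae ((integrable_const ε).indicator hmeas)
          ((hint f hf).sub (hint ystar hystar)) ?_
        filter_upwards [hgap] with x hx
        by_cases h : f x = ystar x
        · simp [h]
        · rw [Set.indicator_of_mem (by exact h)]
          linarith [hx (f x) h]
end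

section
/- Let q (true posterior) and q̃ (noisy posterior) be two class-posteriors as in the context. Suppose there exist ε > 0 and a measurable map y* : X → Fin K such that for μ-a.e. x: (i) q̃ x (y*(x)) ≥ q̃ x y + ε for every y ≠ y*(x), and (ii) q x (y*(x)) = max_y q x y. Then for every measurable classifier f : X → Fin K, R01_q(f) − R01*_q ≤ (1/ε) · (R01_q̃(f) − R01*_q̃). (This is the deterministic core of Theorem 4: the excess misclassification rate on the original distribution is controlled by the excess misclassification rate on the noisy distribution, with constant 1/inf_x Δ(x).) -/
open MeasureTheory

lemma le_one_of_sum_eq_one {ι : Type*} [Fintype ι] {p : ι → ℝ} (h0 : ∀ i, 0 ≤ p i)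
    (h1 : ∑ i, p i = 1) (i : ι) : p i ≤ 1 :=
  h1 ▸ Finset.single_le_sum (fun j _ => h0 j) (Finset.mem_univ i)

lemma measurable_apply_selection {X ι : Type*} [MeasurableSpace X] [MeasurableSpace ι]
    [Countable ι] [MeasurableSingletonClass ι] {q : X → ι → ℝ}
    (hq : ∀ y, Measurable fun x => q x y) {g : X → ι} (hg : Measurable g) :
    Measurable fun x => q x (g x) := by
  have h : Measurable fun p : X × ι => q p.1 p.2 := measurable_from_prod_countable_left hq
  exact h.comp (measurable_id.prodMk hg)

lemma integrable_one_sub_posterior {X ι : Type*} [MeasurableSpace X] (μ : Measure X)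
    [IsFiniteMeasure μ] [Fintype ι] [MeasurableSpace ι] [MeasurableSingletonClass ι]
    {q : X → ι → ℝ} (hqm : ∀ y, Measurable fun x => q x y) (hq0 : ∀ x y, 0 ≤ q x y)
    (hq1 : ∀ x, ∑ y, q x y = 1) {g : X → ι} (hg : Measurable g) :
    Integrable (fun x => 1 - q x (g x)) μ := by
  refine (integrable_const 1).sub (Integrable.of_bound
    (measurable_apply_selection hqm hg).aestronglyMeasurable 1 (ae_of_all _ fun x => ?_))
  rw [Real.norm_of_nonneg (hq0 x _)]
  exact le_one_of_sum_eq_one (hq0 x) (hq1 x) _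

/-- **Deterministic core of Theorem 4.**
If the noisy posterior `q̃` has a uniform margin `ε > 0` at a measurable maximizer map `y*`
which a.e. also maximizes the true posterior `q`, then for every measurable classifier `f`,
the excess misclassification rate on the original distribution is at most `1/ε` times the
excess misclassification rate on the noisy distribution. -/
theorem excess_risk_transfer_noisy_to_true
    {X : Type*} [MeasurableSpace X] (μ : Measure X) [IsProbabilityMeasure μ]
    {K : ℕ} (hK : 2 ≤ K)
    (q qt : X → Fin K → ℝ)
    (hqm : ∀ y, Measurable fun x => q x y) (hq0 : ∀ x y, 0 ≤ q x y)
    (hq1 : ∀ x, ∑ y, q x y = 1)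
    (hqtm : ∀ y, Measurable fun x => qt x y) (hqt0 : ∀ x y, 0 ≤ qt x y)
    (hqt1 : ∀ x, ∑ y, qt x y = 1)
    (ε : ℝ) (hε : 0 < ε)
    (ystar : X → Fin K) (hystar : Measurable ystar)
    (hgap : ∀ᵐ x ∂μ, ∀ y, y ≠ ystar x → qt x y + ε ≤ qt x (ystar x))
    (hmax : ∀ᵐ x ∂μ, q x (ystar x) = ⨆ y, q x y)
    (f : X → Fin K) (hf : Measurable f) :
    (∫ x, (1 - q x (f x)) ∂μ) - (∫ x, (1 - ⨆ y, q x y) ∂μ) ≤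
      (1 / ε) * ((∫ x, (1 - qt x (f x)) ∂μ) - (∫ x, (1 - ⨆ y, qt x y) ∂μ)) := by
  have hbayes : ∫ x, (1 - ⨆ y, q x y) ∂μ = ∫ x, (1 - q x (ystar x)) ∂μ :=
    integral_congr_ae (hmax.mono fun x hx => by simp only [hx])
  have hbayes_noisy : ∫ x, (1 - ⨆ y, qt x y) ∂μ = ∫ x, (1 - qt x (ystar x)) ∂μ := by
    refine integral_congr_ae (hgap.mono fun x hx => ?_)
    have : Nonempty (Fin K) := ⟨ystar x⟩
    have hsup : ⨆ y, qt x y = qt x (ystar x) := by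
      refine le_antisymm (ciSup_le fun y => ?_) (le_ciSup (Set.finite_range _).bddAbove _)
      rcases eq_or_ne y (ystar x) with rfl | hy
      · exact le_rfl
      · linarith [hx y hy]
    simp only [hsup]
  have hint {g : X → Fin K} (hg : Measurable g) := integrable_one_sub_posterior μ hqm hq0 hq1 hg
  have hint_noisy {g : X → Fin K} (hg : Measurable g) :=
    integrable_one_sub_posterior μ hqtm hqt0 hqt1 hg
  rw [hbayes, hbayes_noisy, ← integral_sub (hint hf) (hint hystar),
    ← integral_sub (hint_noisy hf) (hint_noisy hystar), ← integral_const_mul]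
  refine integral_mono_ae ((hint hf).sub (hint hystar))
    (((hint_noisy hf).sub (hint_noisy hystar)).const_mul _) (hgap.mono fun x hx => ?_)
  rcases eq_or_ne (f x) (ystar x) with h | h
  · simp [h]
  · have hle := le_one_of_sum_eq_one (hq0 x) (hq1 x) (ystar x)
    have hgap_f := hx (f x) h
    calc (1 - q x (f x)) - (1 - q x (ystar x)) ≤ 1 := by linarith [hq0 x (f x)]
      _ = 1 / ε * ε := by field_simp
      _ ≤ 1 / ε * ((1 - qt x (f x)) - (1 - qt x (ystar x))) := by
        gcongr
        linarith
end

section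
/- For every δ ∈ (0,1), with probability at least 1 − δ over a sample (x_1,…,x_n) drawn i.i.d. from ν (i.e., from ν^{⊗n}): sup_{g ∈ G} |R̂_SC(g) − R(g)| ≤ (2√2 · π · L_ℓ / C_r) · ∑_{y : Fin K} Rad_n(G_y, ν) + (π · C_ℓ / C_r) · √(log(2/δ) / (2n)). -/
open MeasureTheory

/-- Expected Rademacher complexity of a class `F` of real-valued functions on a sample of
size `n` drawn i.i.d. from `ρ`: the expectation over the sample and over i.i.d. uniform
sign variables of `sup_{f ∈ F} (1/n) ∑ i, σ i * f (x i)`. -/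
noncomputable def rademacherComplexity {X : Type*} [MeasurableSpace X] (ρ : Measure X)
    (n : ℕ) (F : Set (X → ℝ)) : ℝ :=
  ∫ xs : Fin n → X,
    (∑ σ : Fin n → Bool,
        sSup ((fun f : X → ℝ => (∑ i, (if σ i then (1 : ℝ) else -1) * f (xs i)) / n) '' F))
      / 2 ^ n
    ∂(Measure.pi fun _ => ρ)

open scoped BigOperators

/-- The sign `±1` attached to a Boolean. -/
def boolSign (b : Bool) : ℝ := if b then 1 else -1

@[simp] lemma boolSign_true : boolSign true = 1 := rfl

@[simp] lemma boolSign_false : boolSign false = -1 := rfl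

@[simp] lemma boolSign_not (b : Bool) : boolSign (!b) = -boolSign b := by cases b <;> simp

lemma abs_boolSign (b : Bool) : |boolSign b| = 1 := by cases b <;> simp

lemma expect_bool (f : Bool → ℝ) : 𝔼 b, f b = (f true + f false) / 2 := by
  rw [Fintype.expect_eq_sum_div_card]
  simp

lemma expect_fin_succ_pi {S : Type*} [Fintype S] {n : ℕ} (f : (Fin (n + 1) → S) → ℝ) :
    𝔼 s, f s = 𝔼 a : S, 𝔼 s : Fin n → S, f (Fin.cons a s) := by
  rw [← Finset.expect_product', Finset.univ_product_univ]
  exact (Fintype.expect_equiv (Fin.consEquiv fun _ => S) _ _ fun _ => rfl).symm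

lemma expect_cube_succ {n : ℕ} (f : (Fin (n + 1) → Bool) → ℝ) :
    𝔼 s, f s = (𝔼 s : Fin n → Bool, f (Fin.cons true s) +
      𝔼 s : Fin n → Bool, f (Fin.cons false s)) / 2 := by
  rw [expect_fin_succ_pi, expect_bool]

lemma expect_pi_apply {κ S : Type*} [Fintype κ] [DecidableEq κ] [Fintype S] [Nonempty S]
    (k : κ) (f : S → ℝ) : 𝔼 η : κ → S, f (η k) = 𝔼 s, f s := by
  rw [Fintype.expect_equiv (Equiv.funSplitAt k S) (fun η => f (η k)) (fun p => f p.1)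
    fun _ => rfl, ← Finset.univ_product_univ, Finset.expect_product]
  simp

/-- The Dirichlet form on the discrete cube. -/
noncomputable def cubeEnergy {n : ℕ} (f : (Fin n → Bool) → ℝ) : ℝ :=
  (∑ i, 𝔼 s, f s * (f s - f (Function.update s i (!s i)))) / 2

/-- The total squared weight of the degree-one Walsh coefficients. -/
noncomputable def levelOneWeight {n : ℕ} (f : (Fin n → Bool) → ℝ) : ℝ :=
  ∑ i, (𝔼 s, boolSign (s i) * f s) ^ 2

lemma cubeEnergy_add_sub {n : ℕ} (f g : (Fin n → Bool) → ℝ) :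
    cubeEnergy (f + g) + cubeEnergy (f - g) = 2 * (cubeEnergy f + cubeEnergy g) := by
  simp only [cubeEnergy, ← add_div, ← mul_div_assoc, ← Finset.sum_add_distrib,
    ← Finset.expect_add_distrib, Finset.mul_sum, Finset.mul_expect]
  congr 2 with i
  refine Finset.expect_congr rfl fun s _ => ?_
  simp only [Pi.add_apply, Pi.sub_apply]
  ring

lemma cubeEnergy_succ {n : ℕ} (f : (Fin (n + 1) → Bool) → ℝ) :
    cubeEnergy f = (𝔼 s : Fin n → Bool, (f (Fin.cons true s) - f (Fin.cons false s)) ^ 2) / 4 +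
      (cubeEnergy (fun s => f (Fin.cons true s)) +
        cubeEnergy fun s => f (Fin.cons false s)) / 2 := by
  simp only [cubeEnergy, Fin.sum_univ_succ, expect_cube_succ, Fin.cons_zero, Fin.cons_succ,
    Fin.update_cons_zero, ← Fin.cons_update, Bool.not_true, Bool.not_false, ← Finset.sum_div,
    Finset.sum_add_distrib]
  have : 𝔼 s : Fin n → Bool, (f (Fin.cons true s) - f (Fin.cons false s)) ^ 2 =
      𝔼 s : Fin n → Bool, f (Fin.cons true s) * (f (Fin.cons true s) - f (Fin.cons false s)) +
      𝔼 s : Fin n → Bool, f (Fin.cons false s) * (f (Fin.cons false s) - f (Fin.cons true s)) := by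
    rw [← Finset.expect_add_distrib]
    exact Finset.expect_congr rfl fun s _ => by ring
  rw [this]
  ring

lemma sq_expect_le {α : Type*} [Fintype α] [Nonempty α] (f : α → ℝ) :
    (𝔼 s, f s) ^ 2 ≤ 𝔼 s, f s ^ 2 := by
  have := Finset.expect_mul_sq_le_sq_mul_sq Finset.univ f (fun _ => 1)
  simpa using this

/-- The Poincaré inequality on the discrete cube. -/
lemma cube_variance_le_cubeEnergy {n : ℕ} (f : (Fin n → Bool) → ℝ) :
    𝔼 s, f s ^ 2 - (𝔼 s, f s) ^ 2 ≤ cubeEnergy f := by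
  induction n with
  | zero => simp [cubeEnergy]
  | succ n ih =>
    rw [cubeEnergy_succ, expect_cube_succ, expect_cube_succ]
    have h1 := ih fun s => f (Fin.cons true s)
    have h2 := ih fun s => f (Fin.cons false s)
    have h3 := sq_expect_le fun s : Fin n → Bool => f (Fin.cons true s) - f (Fin.cons false s)
    rw [Finset.expect_sub_distrib] at h3
    nlinarith

/-- The second-order Poincaré inequality on the discrete cube. -/
lemma two_mul_cube_variance_le {n : ℕ} (f : (Fin n → Bool) → ℝ) :
    2 * (𝔼 s, f s ^ 2 - (𝔼 s, f s) ^ 2) ≤ cubeEnergy f + levelOneWeight f := by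
  induction n with
  | zero => simp [cubeEnergy, levelOneWeight]
  | succ n ih =>
    set p : (Fin n → Bool) → ℝ := fun s => (f (Fin.cons true s) + f (Fin.cons false s)) / 2
    set q : (Fin n → Bool) → ℝ := fun s => (f (Fin.cons true s) - f (Fin.cons false s)) / 2
    have ht : (fun s => f (Fin.cons true s)) = p + q := by ext s; simp [p, q]; ring
    have hf : (fun s => f (Fin.cons false s)) = p - q := by ext s; simp [p, q]; ring
    have ht' : ∀ s, f (Fin.cons true s) = p s + q s := fun s => congrFun ht s
    have hf' : ∀ s, f (Fin.cons false s) = p s - q s := fun s => congrFun hf s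
    have hW : levelOneWeight f = (𝔼 s, q s) ^ 2 + levelOneWeight p := by
      simp only [levelOneWeight, Fin.sum_univ_succ, expect_cube_succ, Fin.cons_zero, Fin.cons_succ,
        ht', hf', boolSign_true, boolSign_false]
      congr 1
      · congr 1
        rw [← Finset.expect_add_distrib, Finset.expect_div]
        exact Finset.expect_congr rfl fun s _ => by ring
      · refine Finset.sum_congr rfl fun i _ => ?_
        congr 1
        rw [← Finset.expect_add_distrib, Finset.expect_div]
        exact Finset.expect_congr rfl fun s _ => by ring
    have hE : cubeEnergy f = 𝔼 s, q s ^ 2 + (cubeEnergy p + cubeEnergy q) := by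
      rw [cubeEnergy_succ, ht, hf, cubeEnergy_add_sub]
      congr 1
      · rw [Finset.expect_div]
        exact Finset.expect_congr rfl fun s _ => by simp only [ht', hf']; ring
      · ring
    have h2 : 𝔼 s, f s ^ 2 = 𝔼 s, p s ^ 2 + 𝔼 s, q s ^ 2 := by
      rw [expect_cube_succ, ← Finset.expect_add_distrib, ← Finset.expect_add_distrib,
        Finset.expect_div]
      exact Finset.expect_congr rfl fun s _ => by simp only [ht', hf']; ring
    have h1 : 𝔼 s, f s = 𝔼 s, p s := by
      rw [expect_cube_succ, ← Finset.expect_add_distrib, Finset.expect_div]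
    have := ih p
    have := cube_variance_le_cubeEnergy q
    rw [hW, hE, h2, h1]
    linarith

lemma expect_cube_not {n : ℕ} (f : (Fin n → Bool) → ℝ) :
    𝔼 s : Fin n → Bool, f (fun i => !s i) = 𝔼 s, f s :=
  Fintype.expect_equiv (Equiv.piCongrRight fun _ => Equiv.boolNot) _ _ fun _ => rfl

lemma levelOneWeight_eq_zero {n : ℕ} (f : (Fin n → Bool) → ℝ)
    (hf : ∀ s, f (fun i => !s i) = f s) : levelOneWeight f = 0 := by
  refine Finset.sum_eq_zero fun i _ => ?_
  have h := expect_cube_not fun s => boolSign (s i) * f s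
  simp only [boolSign_not, hf, neg_mul, Finset.expect_neg_distrib] at h
  rw [sq_eq_zero_iff]
  linarith

lemma expect_rademacherSum_sq {n : ℕ} (v : Fin n → ℝ) :
    𝔼 s : Fin n → Bool, (∑ i, boolSign (s i) * v i) ^ 2 = ∑ i, v i ^ 2 := by
  induction n with
  | zero => simp
  | succ n ih =>
    rw [expect_cube_succ, ← Finset.expect_add_distrib, Finset.expect_div, Fin.sum_univ_succ, ← ih,
      ← Fintype.expect_const (ι := Fin n → Bool) (v 0 ^ 2), ← Finset.expect_add_distrib]
    refine Finset.expect_congr rfl fun s _ => ?_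
    simp only [Fin.sum_univ_succ, Fin.cons_zero, Fin.cons_succ, boolSign_true, boolSign_false]
    ring

/-- **Khintchine's inequality** in `L¹` with Szarek's optimal constant. -/
lemma sqrt_sum_sq_le_expect_abs_rademacherSum {n : ℕ} (v : Fin n → ℝ) :
    √(∑ i, v i ^ 2) ≤ √2 * 𝔼 s : Fin n → Bool, |∑ i, boolSign (s i) * v i| := by
  set f : (Fin n → Bool) → ℝ := fun s => |∑ i, boolSign (s i) * v i| with hf
  have hW : levelOneWeight f = 0 :=
    levelOneWeight_eq_zero f fun s => by simp [hf, abs_neg]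
  have hflip : ∀ s i, ∑ j, boolSign (Function.update s i (!s i) j) * v j =
      ∑ j, boolSign (s j) * v j - 2 * (boolSign (s i) * v i) := by
    intro s i
    rw [← Finset.add_sum_erase _ _ (Finset.mem_univ i),
      ← Finset.add_sum_erase _ (fun j => boolSign (s j) * v j) (Finset.mem_univ i)]
    have : ∑ j ∈ Finset.univ.erase i, boolSign (Function.update s i (!s i) j) * v j =
        ∑ j ∈ Finset.univ.erase i, boolSign (s j) * v j :=
      Finset.sum_congr rfl fun j hj => by
        rw [Function.update_of_ne (Finset.ne_of_mem_erase hj)]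
    rw [this]
    simp
    ring
  have hpt : ∀ s, ∑ i, (f s - f (Function.update s i (!s i))) ≤ 2 * f s := by
    intro s
    have h1 : ∑ i, (∑ j, boolSign (s j) * v j - 2 * (boolSign (s i) * v i)) =
        (n - 2) * ∑ j, boolSign (s j) * v j := by
      rw [Finset.sum_sub_distrib, ← Finset.mul_sum]
      simp
      ring
    have h2 := Finset.abs_sum_le_sum_abs
      (fun i => ∑ j, boolSign (s j) * v j - 2 * (boolSign (s i) * v i)) Finset.univ
    rw [h1, abs_mul] at h2
    have h3 : ((n : ℝ) - 2) * f s ≤ |(n : ℝ) - 2| * f s :=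
      mul_le_mul_of_nonneg_right (le_abs_self _) (abs_nonneg _)
    simp only [Finset.sum_sub_distrib, Finset.sum_const, Finset.card_univ, Fintype.card_fin,
      nsmul_eq_mul]
    have h4 : ∑ i, f (Function.update s i (!s i)) =
      ∑ i, |∑ j, boolSign (s j) * v j - 2 * (boolSign (s i) * v i)| :=
      Finset.sum_congr rfl fun i _ => by simp only [hf, hflip]
    rw [h4]
    linarith
  have hE : cubeEnergy f ≤ 𝔼 s, f s ^ 2 := by
    rw [cubeEnergy, ← Finset.expect_sum_comm, Finset.expect_div]
    refine Finset.expect_le_expect fun s _ => ?_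
    rw [← Finset.mul_sum]
    have := mul_le_mul_of_nonneg_left (hpt s) (abs_nonneg (∑ i, boolSign (s i) * v i))
    change f s * _ ≤ f s * _ at this
    linarith
  have hV := two_mul_cube_variance_le f
  have hS : 𝔼 s, f s ^ 2 = ∑ i, v i ^ 2 := by
    simp only [hf, sq_abs]
    exact expect_rademacherSum_sq v
  have h0 : 0 ≤ 𝔼 s, f s := Finset.expect_nonneg fun s _ => abs_nonneg _
  refine Real.sqrt_le_iff.2 ⟨by positivity, ?_⟩
  rw [mul_pow, Real.sq_sqrt (by norm_num), ← hS]
  linarith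

lemma ciSup_add_ciSup_le_of_forall {ι κ : Type*} [Nonempty ι] [Nonempty κ] {f : ι → ℝ} {g : κ → ℝ}
    {c : ℝ} (h : ∀ i j, f i + g j ≤ c) : (⨆ i, f i) + ⨆ j, g j ≤ c := by
  have : ⨆ i, f i ≤ c - ⨆ j, g j := ciSup_le fun i => by
    have : ⨆ j, g j ≤ c - f i := ciSup_le fun j => by linarith [h i j]
    linarith
  linarith

lemma bddAbove_range_of_abs_le {ι : Type*} {f : ι → ℝ} {C : ℝ} (h : ∀ i, |f i| ≤ C) :
    BddAbove (Set.range f) :=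
  ⟨C, by rintro _ ⟨i, rfl⟩; exact (abs_le.1 (h i)).2⟩

lemma abs_ciSup_le {ι : Type*} [Nonempty ι] {f : ι → ℝ} {C : ℝ} (h : ∀ i, |f i| ≤ C) :
    |⨆ i, f i| ≤ C := by
  refine abs_le.2 ⟨?_, ciSup_le fun i => (abs_le.1 (h i)).2⟩
  obtain ⟨i⟩ := ‹Nonempty ι›
  exact (abs_le.1 (h i)).1.trans (le_ciSup (bddAbove_range_of_abs_le h) i)

lemma abs_rademacherSum_le {n : ℕ} (s : Fin n → Bool) (v : Fin n → ℝ) {C : ℝ}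
    (h : ∀ i, |v i| ≤ C) : |∑ i, boolSign (s i) * v i| ≤ n * C := by
  refine (Finset.abs_sum_le_sum_abs _ _).trans ?_
  refine (Finset.sum_le_card_nsmul _ _ C fun i _ => ?_).trans (by simp)
  rw [abs_mul, abs_boolSign, one_mul]
  exact h i

lemma expect_ciSup_contraction_single {ι : Type*} [Nonempty ι] {K : ℕ} {A ψ : ι → ℝ}
    {a : ι → EuclideanSpace ℝ (Fin K)} {L C D : ℝ} (hL : 0 ≤ L) (hA : ∀ g, |A g| ≤ C)
    (ha : ∀ g k, |a g k| ≤ D) (hψ : ∀ g g', |ψ g - ψ g'| ≤ L * ‖a g - a g'‖) :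
    𝔼 b, ⨆ g, (A g + boolSign b * ψ g) ≤
      𝔼 ε : Fin K → Bool, ⨆ g, (A g + √2 * L * ∑ k, boolSign (ε k) * a g k) := by
  set S : (Fin K → Bool) → ℝ := fun ε => ⨆ g, (A g + √2 * L * ∑ k, boolSign (ε k) * a g k) with hS
  have hle : ∀ ε g, A g + √2 * L * ∑ k, boolSign (ε k) * a g k ≤ S ε := by
    intro ε g
    refine le_ciSup (f := fun g => A g + √2 * L * ∑ k, boolSign (ε k) * a g k)
      (bddAbove_range_of_abs_le (C := C + √2 * L * (K * D)) fun g => ?_) g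
    refine (abs_add_le _ _).trans (add_le_add (hA g) ?_)
    rw [abs_mul, abs_of_nonneg (by positivity : 0 ≤ √2 * L)]
    exact mul_le_mul_of_nonneg_left (abs_rademacherSum_le _ _ (ha g)) (by positivity)
  have hneg : ∀ (ε : Fin K → Bool) g,
      A g - √2 * L * ∑ k, boolSign (ε k) * a g k ≤ S (fun k => !ε k) := by
    intro ε g
    have := hle (fun k => !ε k) g
    simp only [boolSign_not, neg_mul, Finset.sum_neg_distrib] at this
    linarith
  rw [expect_bool]
  suffices h : (⨆ g, (A g + boolSign true * ψ g)) + ⨆ g, (A g + boolSign false * ψ g) ≤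
      2 * 𝔼 ε, S ε by linarith
  refine ciSup_add_ciSup_le_of_forall fun g g' => ?_
  have hK := sqrt_sum_sq_le_expect_abs_rademacherSum fun k => a g k - a g' k
  have hnorm : ‖a g - a g'‖ = √(∑ k, (a g k - a g' k) ^ 2) := by
    rw [EuclideanSpace.norm_eq]
    simp
  have h1 : ψ g - ψ g' ≤
      √2 * L * 𝔼 ε : Fin K → Bool, |∑ k, boolSign (ε k) * (a g k - a g' k)| := by
    have := mul_le_mul_of_nonneg_left hK hL
    rw [← hnorm] at this
    linarith [(abs_le.1 (hψ g g')).2]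
  have h2 : 𝔼 ε : Fin K → Bool, (A g + A g' +
      √2 * L * |∑ k, boolSign (ε k) * (a g k - a g' k)|) ≤
      𝔼 ε, (S ε + S fun k => !ε k) := by
    refine Finset.expect_le_expect fun ε _ => ?_
    have e : ∑ k, boolSign (ε k) * (a g k - a g' k) =
        ∑ k, boolSign (ε k) * a g k - ∑ k, boolSign (ε k) * a g' k := by
      rw [← Finset.sum_sub_distrib]
      exact Finset.sum_congr rfl fun k _ => by ring
    rw [e]
    rcases abs_cases (∑ k, boolSign (ε k) * a g k - ∑ k, boolSign (ε k) * a g' k) with h | h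
    · rw [h.1]
      linarith [hle ε g, hneg ε g']
    · rw [h.1]
      linarith [hle ε g', hneg ε g]
  rw [Finset.expect_add_distrib, Finset.expect_add_distrib, Finset.expect_add_distrib,
    expect_cube_not, Fintype.expect_const, Fintype.expect_const, ← Finset.mul_expect] at h2
  simp only [boolSign_true, boolSign_false]
  linarith

lemma expect_ciSup_contraction {ι : Type*} [Nonempty ι] {K n : ℕ} {A : ι → ℝ}
    {ψ : Fin n → ι → ℝ} {a : Fin n → ι → EuclideanSpace ℝ (Fin K)} {L C D : ℝ} (hL : 0 ≤ L)
    (hA : ∀ g, |A g| ≤ C) (ha : ∀ i g k, |a i g k| ≤ D)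
    (hψ : ∀ i g g', |ψ i g - ψ i g'| ≤ L * ‖a i g - a i g'‖)
    (hψb : ∀ i g, |ψ i g| ≤ C) :
    𝔼 σ : Fin n → Bool, ⨆ g, (A g + ∑ i, boolSign (σ i) * ψ i g) ≤
      𝔼 ε : Fin n → Fin K → Bool,
        ⨆ g, (A g + √2 * L * ∑ i, ∑ k, boolSign (ε i k) * a i g k) := by
  induction n generalizing A C with
  | zero => simp
  | succ n ih =>
    rw [expect_fin_succ_pi, expect_fin_succ_pi (S := Fin K → Bool)]
    simp only [Fin.sum_univ_succ, Fin.cons_zero, Fin.cons_succ]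
    have h1 : ∀ b : Bool, 𝔼 σ : Fin n → Bool, ⨆ g, (A g + (boolSign b * ψ 0 g +
        ∑ i : Fin n, boolSign (σ i) * ψ i.succ g)) ≤
        𝔼 ε : Fin n → Fin K → Bool, ⨆ g, (A g + √2 * L * (∑ i : Fin n, ∑ k,
          boolSign (ε i k) * a i.succ g k) + boolSign b * ψ 0 g) := by
      intro b
      have := ih (A := fun g => A g + boolSign b * ψ 0 g) (C := C + C)
        (ψ := fun i => ψ i.succ) (a := fun i => a i.succ) ?_ (fun i => ha _) (fun i => hψ _) ?_
      · convert this using 4 <;> ring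
      · intro g
        refine (abs_add_le _ _).trans (add_le_add (hA g) ?_)
        rw [abs_mul, abs_boolSign, one_mul]
        exact hψb 0 g
      · intro i g
        have := (abs_nonneg _).trans (hψb i.succ g)
        linarith [hψb i.succ g]
    refine (Finset.expect_le_expect fun b _ => h1 b).trans ?_
    rw [Finset.expect_comm, Finset.expect_comm (s := (Finset.univ : Finset (Fin K → Bool)))]
    refine Finset.expect_le_expect fun ε _ => ?_
    have := expect_ciSup_contraction_single (ψ := ψ 0) (a := a 0) (C := C + √2 * L * (n * (K * D)))
      (A := fun g => A g + √2 * L * (∑ i : Fin n, ∑ k, boolSign (ε i k) * a i.succ g k))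
      hL ?_ (ha 0) (hψ 0)
    · refine this.trans_eq (Finset.expect_congr rfl fun ε' _ => iSup_congr fun g => ?_)
      ring
    · intro g
      refine (abs_add_le _ _).trans (add_le_add (hA g) ?_)
      rw [abs_mul, abs_of_nonneg (by positivity : 0 ≤ √2 * L)]
      refine mul_le_mul_of_nonneg_left ?_ (by positivity)
      refine (Finset.abs_sum_le_sum_abs _ _).trans ?_
      refine (Finset.sum_le_card_nsmul _ _ (K * D) fun i _ => ?_).trans (by simp)
      exact abs_rademacherSum_le _ _ (ha _ g)

/-- **Maurer's vector contraction inequality**, with the coordinates of the vector-valued class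
separated. -/
lemma expect_ciSup_vector_contraction {ι : Type*} [Nonempty ι] {K n : ℕ}
    {ψ : Fin n → ι → ℝ} {a : Fin n → ι → EuclideanSpace ℝ (Fin K)} {L C D : ℝ} (hL : 0 ≤ L)
    (ha : ∀ i g k, |a i g k| ≤ D)
    (hψ : ∀ i g g', |ψ i g - ψ i g'| ≤ L * ‖a i g - a i g'‖)
    (hψb : ∀ i g, |ψ i g| ≤ C) :
    𝔼 σ : Fin n → Bool, ⨆ g, ∑ i, boolSign (σ i) * ψ i g ≤
      √2 * L * ∑ k, 𝔼 σ : Fin n → Bool, ⨆ g, ∑ i, boolSign (σ i) * a i g k := by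
  rcases Nat.eq_zero_or_pos n with rfl | hn
  · simp
  have hC : 0 ≤ C := by
    obtain ⟨g⟩ := ‹Nonempty ι›
    exact (abs_nonneg _).trans (hψb ⟨0, hn⟩ g)
  have h := expect_ciSup_contraction (A := fun _ : ι => (0 : ℝ)) hL (by simpa using hC) ha hψ hψb
  simp only [zero_add] at h
  refine h.trans ?_
  have hm : ∀ k, 𝔼 σ : Fin n → Bool, ⨆ g, ∑ i, boolSign (σ i) * a i g k =
      𝔼 ε : Fin n → Fin K → Bool, ⨆ g, ∑ i, boolSign (ε i k) * a i g k := by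
    intro k
    rw [← expect_pi_apply k fun σ : Fin n → Bool => ⨆ g, ∑ i, boolSign (σ i) * a i g k]
    exact Fintype.expect_equiv (Equiv.piComm fun _ _ => Bool) _ _ fun _ => rfl
  simp only [hm]
  rw [← Finset.expect_sum_comm, Finset.mul_expect]
  refine Finset.expect_le_expect fun ε _ => ciSup_le fun g => ?_
  refine mul_le_mul_of_nonneg_left ?_ (by positivity)
  rw [Finset.sum_comm]
  refine Finset.sum_le_sum fun k _ => ?_
  exact le_ciSup (f := fun g => ∑ i, boolSign (ε i k) * a i g k)
    (bddAbove_range_of_abs_le fun g => abs_rademacherSum_le (fun i => ε i k) _ fun i => ha i g k) g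

lemma measurePreserving_fin_cons {X : Type*} [MeasurableSpace X] (ρ : Measure X)
    [IsProbabilityMeasure ρ] (n : ℕ) :
    MeasurePreserving (fun p : X × (Fin n → X) => (Fin.cons p.1 p.2 : Fin (n + 1) → X))
      (ρ.prod (Measure.pi fun _ => ρ)) (Measure.pi fun _ => ρ) := by
  convert (measurePreserving_piFinSuccAbove (fun _ : Fin (n + 1) => ρ) 0).symm using 1
  ext p i
  simp [MeasurableEquiv.piFinSuccAbove]

lemma integrable_of_abs_le {Ω : Type*} [MeasurableSpace Ω] {P : Measure Ω} [IsFiniteMeasure P]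
    {f : Ω → ℝ} (hf : Measurable f) {C : ℝ} (h : ∀ x, |f x| ≤ C) : Integrable f P :=
  .of_bound hf.aestronglyMeasurable C (.of_forall h)

lemma abs_integral_le_of_abs_le {Ω : Type*} [MeasurableSpace Ω] {P : Measure Ω}
    [IsProbabilityMeasure P] {f : Ω → ℝ} {C : ℝ} (h : ∀ x, |f x| ≤ C) : |∫ x, f x ∂P| ≤ C := by
  simpa using norm_integral_le_of_norm_le_const (μ := P) (f := f) (.of_forall h)

lemma integral_fin_cons {X : Type*} [MeasurableSpace X] (ρ : Measure X)
    [IsProbabilityMeasure ρ] {n : ℕ} {f : (Fin (n + 1) → X) → ℝ} (hf : Measurable f) {C : ℝ}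
    (h : ∀ x, |f x| ≤ C) :
    ∫ xs, f xs ∂(Measure.pi fun _ => ρ) =
      ∫ x, ∫ xs : Fin n → X, f (Fin.cons x xs) ∂(Measure.pi fun _ => ρ) ∂ρ := by
  have hm := measurePreserving_fin_cons ρ n
  rw [← hm.map_eq, integral_map hm.measurable.aemeasurable hf.aestronglyMeasurable]
  exact integral_prod _ (integrable_of_abs_le (hf.comp hm.measurable) fun p => h _)

open ProbabilityTheory NNReal in
/-- Functions of independent variables with bounded differences are sub-Gaussian. -/
lemma hasSubgaussianMGF_of_bounded_differences {X : Type*} [MeasurableSpace X] (ρ : Measure X)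
    [IsProbabilityMeasure ρ] {n : ℕ} {f : (Fin n → X) → ℝ} (hf : Measurable f) {C c : ℝ}
    (hfC : ∀ xs, |f xs| ≤ C)
    (hfc : ∀ xs i x, |f (Function.update xs i x) - f xs| ≤ c) :
    HasSubgaussianMGF (fun xs => f xs - ∫ ys, f ys ∂(Measure.pi fun _ => ρ))
      (n * (‖c‖₊ / 2) ^ 2) (Measure.pi fun _ => ρ) := by
  have hbd : ∀ (n : ℕ) (f : (Fin n → X) → ℝ), (∀ xs, |f xs| ≤ C) → ∀ (t : ℝ) xs,
      |Real.exp (t * (f xs - ∫ ys, f ys ∂(Measure.pi fun _ => ρ)))| ≤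
        Real.exp (|t| * (C + C)) := by
    intro n f hfC t xs
    rw [Real.abs_exp]
    refine Real.exp_le_exp.2 ((le_abs_self _).trans ?_)
    rw [abs_mul]
    exact mul_le_mul_of_nonneg_left ((abs_sub _ _).trans
      (add_le_add (hfC xs) (abs_integral_le_of_abs_le hfC))) (abs_nonneg _)
  refine ⟨fun t => integrable_of_abs_le (by fun_prop) (hbd n f hfC t), fun t => ?_⟩
  simp only [mgf]
  induction n with
  | zero =>
    rw [Measure.pi_of_empty _ (default : Fin 0 → X)]
    simp
  | succ n ih =>
    set P : Measure (Fin n → X) := Measure.pi fun _ => ρ with hP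
    have hcons : Measurable fun p : X × (Fin n → X) => (Fin.cons p.1 p.2 : Fin (n + 1) → X) :=
      (measurePreserving_fin_cons ρ n).measurable
    have hcons' : ∀ x : X, Measurable fun xs : Fin n → X => (Fin.cons x xs : Fin (n + 1) → X) :=
      fun x => hcons.comp measurable_prodMk_left
    set F : X → ℝ := fun x => ∫ xs, f (Fin.cons x xs) ∂P with hF
    have hFm : Measurable F :=
      ((hf.comp hcons).stronglyMeasurable.integral_prod_right' (ν := P)).measurable
    have hFC : ∀ x, |F x| ≤ C := fun x => abs_integral_le_of_abs_le fun xs => hfC _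
    have hfi : ∀ x, Integrable (fun xs => f (Fin.cons x xs)) P := fun x =>
      integrable_of_abs_le (hf.comp (hcons' x)) fun xs => hfC _
    have hFd : ∀ x x', F x ≤ F x' + c := by
      intro x x'
      have : F x - F x' ≤ c := by
        simp only [hF]
        rw [← integral_sub (hfi x) (hfi x')]
        refine (le_abs_self _).trans (abs_integral_le_of_abs_le fun xs => ?_)
        have := hfc (Fin.cons x' xs) 0 x
        rwa [Fin.update_cons_zero] at this
      linarith
    have hm : ∫ ys, f ys ∂(Measure.pi fun _ => ρ) = ∫ x, F x ∂ρ := integral_fin_cons ρ hf hfC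
    rw [integral_fin_cons ρ (by fun_prop) (hbd _ f hfC t), hm]
    have hne : Nonempty X := nonempty_of_isProbabilityMeasure ρ
    have hbelow : BddBelow (Set.range F) :=
      ⟨-C, by rintro _ ⟨x, rfl⟩; exact (abs_le.1 (hFC x)).1⟩
    have hHoeff := (hasSubgaussianMGF_of_mem_Icc (X := F) (μ := ρ) (a := ⨅ x, F x)
      (b := (⨅ x, F x) + c) hFm.aemeasurable (.of_forall fun x => ⟨ciInf_le hbelow x, by
        have : F x - c ≤ ⨅ x, F x := le_ciInf fun x' => by linarith [hFd x x']
        linarith⟩))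
    have hHoeff_t := hHoeff.mgf_le t
    rw [add_sub_cancel_left, mgf] at hHoeff_t
    have hstep : ∀ x, ∫ xs, Real.exp (t * (f (Fin.cons x xs) - ∫ x, F x ∂ρ)) ∂P ≤
        Real.exp (t * (F x - ∫ x, F x ∂ρ)) *
          Real.exp ((n * (‖c‖₊ / 2) ^ 2 : ℝ≥0) * t ^ 2 / 2) := by
      intro x
      have := ih (f := fun xs => f (Fin.cons x xs)) (hf.comp (hcons' x)) (fun xs => hfC _)
        fun xs i y => by
          have := hfc (Fin.cons x xs) i.succ y
          rwa [← Fin.cons_update] at this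
      refine le_trans (le_of_eq ?_) (mul_le_mul_of_nonneg_left this (Real.exp_pos _).le)
      rw [← integral_const_mul]
      refine integral_congr_ae (.of_forall fun xs => ?_)
      simp only [← Real.exp_add]
      congr 1
      simp only [hF]
      ring
    have hexpm : Measurable fun p : X × (Fin n → X) =>
        Real.exp (t * (f (Fin.cons p.1 p.2) - ∫ x, F x ∂ρ)) :=
      (((hf.comp hcons).sub_const _).const_mul t).exp
    have hint : Integrable (fun x => ∫ xs, Real.exp (t * (f (Fin.cons x xs) - ∫ x, F x ∂ρ)) ∂P)
        ρ := by
      refine integrable_of_abs_le (C := Real.exp (|t| * (C + C)))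
        (hexpm.stronglyMeasurable.integral_prod_right' (ν := P)).measurable fun x => ?_
      refine abs_integral_le_of_abs_le fun xs => ?_
      rw [← hm]
      exact hbd _ f hfC t _
    refine (integral_mono hint ((hHoeff.integrable_exp_mul t).mul_const _) hstep).trans ?_
    rw [integral_mul_const]
    refine (mul_le_mul_of_nonneg_right hHoeff_t (Real.exp_pos _).le).trans_eq ?_
    rw [← Real.exp_add]
    congr 1
    push_cast
    ring

/-- **McDiarmid's inequality.** -/
lemma measure_ge_le_of_bounded_differences {X : Type*} [MeasurableSpace X] (ρ : Measure X)
    [IsProbabilityMeasure ρ] {n : ℕ} {f : (Fin n → X) → ℝ} (hf : Measurable f) {C c s : ℝ}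
    (hfC : ∀ xs, |f xs| ≤ C)
    (hfc : ∀ xs i x, |f (Function.update xs i x) - f xs| ≤ c) (hs : 0 ≤ s) :
    (Measure.pi fun _ => ρ).real {xs | s ≤ f xs - ∫ ys, f ys ∂(Measure.pi fun _ => ρ)} ≤
      Real.exp (-2 * s ^ 2 / (n * c ^ 2)) := by
  refine ((hasSubgaussianMGF_of_bounded_differences ρ hf hfC hfc).measure_ge_le hs).trans_eq ?_
  congr 1
  push_cast
  rw [div_pow, Real.norm_eq_abs, sq_abs,
    show 2 * ((n : ℝ) * (c ^ 2 / 2 ^ 2)) = n * c ^ 2 / 2 by ring, div_div_eq_mul_div]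
  ring

section Symmetrization

variable {X : Type*} {ι : Type*} {n : ℕ}

/-- The empirical Rademacher complexity of an indexed class of functions. -/
noncomputable def empiricalRademacher (h : ι → X → ℝ) (xs : Fin n → X) : ℝ :=
  𝔼 σ : Fin n → Bool, ⨆ g, (∑ i, boolSign (σ i) * h g (xs i)) / n

lemma empiricalRademacher_neg (h : ι → X → ℝ) (xs : Fin n → X) :
    empiricalRademacher (fun g x => -h g x) xs = empiricalRademacher h xs := by
  simp only [empiricalRademacher]
  rw [← expect_cube_not]
  simp

lemma abs_rademacherAverage_le {h : ι → X → ℝ} {B : ℝ} (hB : ∀ g x, |h g x| ≤ B)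
    (hB0 : 0 ≤ B) (σ : Fin n → Bool) (xs : Fin n → X) (g : ι) :
    |(∑ i, boolSign (σ i) * h g (xs i)) / n| ≤ B := by
  rw [abs_div, Nat.abs_cast]
  exact div_le_of_le_mul₀ n.cast_nonneg hB0 ((abs_rademacherSum_le σ _ fun i => hB g _).trans_eq
    (mul_comm _ _))

lemma abs_average_le {h : X → ℝ} {B : ℝ} (hB : ∀ x, |h x| ≤ B)
    (hB0 : 0 ≤ B) (xs : Fin n → X) : |(∑ i, h (xs i)) / n| ≤ B := by
  simpa using abs_rademacherAverage_le (h := fun _ : Unit => h) (fun _ => hB) hB0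
    (fun _ => true) xs ()

lemma rademacherComplexity_range [MeasurableSpace X] (ρ : Measure X) (h : ι → X → ℝ) :
    rademacherComplexity ρ n (Set.range h) =
      ∫ xs, empiricalRademacher h xs ∂(Measure.pi fun _ : Fin n => ρ) := by
  simp only [rademacherComplexity, empiricalRademacher, Fintype.expect_eq_sum_div_card,
    ← Set.range_comp, sSup_range]
  simp [boolSign, Function.comp_def]

lemma measurable_empiricalRademacher [MeasurableSpace X] [Countable ι] {h : ι → X → ℝ}
    (hm : ∀ g, Measurable (h g)) :
    Measurable (empiricalRademacher h : (Fin n → X) → ℝ) := by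
  unfold empiricalRademacher
  simp only [Fintype.expect_eq_sum_div_card]
  refine (Finset.measurable_sum _ fun σ _ => .iSup fun g => ?_).div_const _
  fun_prop

lemma empiricalRademacher_eq (h : ι → X → ℝ) (xs : Fin n → X) :
    empiricalRademacher h xs =
      (n : ℝ)⁻¹ * 𝔼 σ : Fin n → Bool, ⨆ g, ∑ i, boolSign (σ i) * h g (xs i) := by
  rw [Finset.mul_expect]
  refine Finset.expect_congr rfl fun σ _ => ?_
  rw [Real.mul_iSup_of_nonneg (by positivity)]
  exact iSup_congr fun g => div_eq_inv_mul _ _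

variable [Nonempty ι]

lemma abs_ciSup_sub_ciSup_le {f g : ι → ℝ} {C c : ℝ} (hf : ∀ i, |f i| ≤ C) (hg : ∀ i, |g i| ≤ C)
    (h : ∀ i, |f i - g i| ≤ c) : |(⨆ i, f i) - ⨆ i, g i| ≤ c := by
  have h1 : ⨆ i, f i ≤ (⨆ i, g i) + c := ciSup_le fun i => by
    linarith [(abs_le.1 (h i)).2, le_ciSup (bddAbove_range_of_abs_le hg) i]
  have h2 : ⨆ i, g i ≤ (⨆ i, f i) + c := ciSup_le fun i => by
    linarith [(abs_le.1 (h i)).1, le_ciSup (bddAbove_range_of_abs_le hf) i]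
  exact abs_le.2 ⟨by linarith, by linarith⟩

lemma abs_empiricalRademacher_le {h : ι → X → ℝ} {B : ℝ} (hB : ∀ g x, |h g x| ≤ B)
    (hB0 : 0 ≤ B) (xs : Fin n → X) : |empiricalRademacher h xs| ≤ B :=
  (Finset.abs_expect_le _ _).trans <| Finset.expect_le Finset.univ_nonempty fun σ _ =>
    abs_ciSup_le fun g => abs_rademacherAverage_le hB hB0 σ xs g

lemma empiricalRademacher_nonneg {h : ι → X → ℝ} {B : ℝ} (hB : ∀ g x, |h g x| ≤ B)
    (xs : Fin n → X) : 0 ≤ empiricalRademacher h xs := by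
  obtain ⟨g⟩ := ‹Nonempty ι›
  rcases n.eq_zero_or_pos with rfl | hn
  · simp [empiricalRademacher]
  have hB0 : 0 ≤ B := (abs_nonneg _).trans (hB g (xs ⟨0, hn⟩))
  have h0 : 𝔼 σ : Fin n → Bool, (∑ i, boolSign (σ i) * h g (xs i)) / n = 0 := by
    have := expect_cube_not fun σ : Fin n → Bool => (∑ i, boolSign (σ i) * h g (xs i)) / n
    simp only [boolSign_not, neg_mul, Finset.sum_neg_distrib, neg_div,
      Finset.expect_neg_distrib] at this
    linarith
  rw [← h0]
  exact Finset.expect_le_expect fun σ _ => le_ciSup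
    (bddAbove_range_of_abs_le fun g => abs_rademacherAverage_le hB hB0 σ xs g) g

variable [MeasurableSpace X] [Countable ι]

set_option maxHeartbeats 1000000 in
/-- **Symmetrization**: the expected uniform deviation is at most twice the Rademacher
complexity. -/
lemma integral_ciSup_sub_average_le (ρ : Measure X) [IsProbabilityMeasure ρ] {h : ι → X → ℝ}
    (hm : ∀ g, Measurable (h g)) {B : ℝ} (hB : ∀ g x, |h g x| ≤ B) (hn : 0 < n) :
    ∫ xs, ⨆ g, (∫ x, h g x ∂ρ - (∑ i, h g (xs i)) / n) ∂(Measure.pi fun _ : Fin n => ρ) ≤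
      2 * ∫ xs, empiricalRademacher h xs ∂(Measure.pi fun _ : Fin n => ρ) := by
  have hn' : (n : ℝ) ≠ 0 := by positivity
  have hB0 : 0 ≤ B := by
    obtain ⟨g⟩ := ‹Nonempty ι›
    obtain ⟨x⟩ := nonempty_of_isProbabilityMeasure ρ
    exact (abs_nonneg _).trans (hB g x)
  set P : Measure (Fin n → X) := Measure.pi fun _ => ρ with hP
  set Q : Measure (Fin n → X × X) := Measure.pi fun _ => ρ.prod ρ with hQ
  have hfst : MeasurePreserving (fun (z : Fin n → X × X) i => (z i).1) Q P :=
    measurePreserving_pi _ _ fun _ => measurePreserving_fst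
  have hsnd : MeasurePreserving (fun (z : Fin n → X × X) i => (z i).2) Q P :=
    measurePreserving_pi _ _ fun _ => measurePreserving_snd
  set Φ : (Fin n → X) → (Fin n → X) → ℝ := fun xs ys =>
    ⨆ g, ((∑ i, h g (ys i)) / n - (∑ i, h g (xs i)) / n) with hΦ
  have hΦb : ∀ (xs ys : Fin n → X) g, |(∑ i, h g (ys i)) / n - (∑ i, h g (xs i)) / n| ≤ B + B :=
    fun xs ys g => (abs_sub _ _).trans
      (add_le_add (abs_average_le (hB g) hB0 _) (abs_average_le (hB g) hB0 _))
  have hΦB : ∀ xs ys, |Φ xs ys| ≤ B + B := fun xs ys => abs_ciSup_le (hΦb xs ys)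
  have hΦm : Measurable fun p : (Fin n → X) × (Fin n → X) => Φ p.1 p.2 := by
    refine .iSup fun g => ?_
    fun_prop
  have hΦm' : ∀ xs, Measurable (Φ xs) := fun xs => hΦm.comp measurable_prodMk_left
  have hmean : ∀ g, ∫ ys, (∑ i, h g (ys i)) / n ∂P = ∫ x, h g x ∂ρ := by
    intro g
    rw [integral_div, integral_finsetSum]
    · have : ∀ i : Fin n, ∫ ys, h g (ys i) ∂P = ∫ x, h g x ∂ρ := fun i => by
        rw [← (measurePreserving_eval (fun _ => ρ) i).map_eq,
          integral_map (measurable_pi_apply i).aemeasurable (hm g).aestronglyMeasurable]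
      simp [this, hn']
    · exact fun i _ => integrable_of_abs_le ((hm g).comp (measurable_pi_apply i)) fun _ => hB g _
  have hghost : ∀ xs, ⨆ g, (∫ x, h g x ∂ρ - (∑ i, h g (xs i)) / n) ≤ ∫ ys, Φ xs ys ∂P := by
    intro xs
    refine ciSup_le fun g => ?_
    have hi : Integrable (fun ys : Fin n → X => (∑ i, h g (ys i)) / n) P :=
      integrable_of_abs_le (by fun_prop) fun ys => abs_average_le (hB g) hB0 ys
    rw [← hmean g]
    calc _ = ∫ ys, ((∑ i, h g (ys i)) / n - (∑ i, h g (xs i)) / n) ∂P := by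
          rw [integral_sub hi (integrable_const _)]
          simp
      _ ≤ _ := integral_mono (hi.sub (integrable_const _))
          (integrable_of_abs_le (hΦm' xs) (hΦB xs)) fun ys =>
            le_ciSup (bddAbove_range_of_abs_le (hΦb xs ys)) g
  have hQint : ∫ xs, ∫ ys, Φ xs ys ∂P ∂P =
      ∫ z, Φ (fun i => (z i).1) (fun i => (z i).2) ∂Q := by
    have he := measurePreserving_arrowProdEquivProdArrow X X (Fin n) (fun _ => ρ) (fun _ => ρ)
    rw [← integral_prod (fun p : (Fin n → X) × (Fin n → X) => Φ p.1 p.2)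
      (integrable_of_abs_le hΦm fun p => hΦB _ _)]
    exact (he.integral_comp' fun p : (Fin n → X) × (Fin n → X) => Φ p.1 p.2).symm
  have hswap : ∀ σ : Fin n → Bool, ∫ z, Φ (fun i => (z i).1) (fun i => (z i).2) ∂Q =
      ∫ z, ⨆ g, ((∑ i, boolSign (σ i) * h g (z i).2) / n -
        (∑ i, boolSign (σ i) * h g (z i).1) / n) ∂Q := by
    intro σ
    have hT : MeasurePreserving
        (fun (z : Fin n → X × X) i => (if σ i then id else Prod.swap : X × X → X × X) (z i)) Q Q :=
      measurePreserving_pi _ _ fun i => by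
        split_ifs
        · exact .id _
        · exact Measure.measurePreserving_swap
    have hΦQ : Measurable fun z : Fin n → X × X =>
        ⨆ g, ((∑ i, h g (z i).2) / n - (∑ i, h g (z i).1) / n) := by
      refine .iSup fun g => ?_
      fun_prop
    have hΦQ' : AEStronglyMeasurable (fun z : Fin n → X × X =>
        ⨆ g, ((∑ i, h g (z i).2) / n - (∑ i, h g (z i).1) / n)) (Q.map
          fun z i => (if σ i then id else Prod.swap : X × X → X × X) (z i)) :=
      hΦQ.aestronglyMeasurable
    simp only [hΦ]
    conv_lhs => rw [← hT.map_eq]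
    rw [integral_map hT.measurable.aemeasurable hΦQ']
    refine integral_congr_ae (.of_forall fun z => iSup_congr fun g => ?_)
    simp only [← sub_div, ← Finset.sum_sub_distrib]
    congr 1
    refine Finset.sum_congr rfl fun i _ => ?_
    cases σ i <;> simp [neg_add_eq_sub]
  have hRm : Measurable (empiricalRademacher h : (Fin n → X) → ℝ) :=
    measurable_empiricalRademacher hm
  have hRi : Integrable (empiricalRademacher h : (Fin n → X) → ℝ) P :=
    integrable_of_abs_le hRm (abs_empiricalRademacher_le hB hB0)
  have hσb : ∀ (σ : Fin n → Bool) (z : Fin n → X × X) g,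
      |(∑ i, boolSign (σ i) * h g (z i).2) / n - (∑ i, boolSign (σ i) * h g (z i).1) / n| ≤
        B + B := fun σ z g => (abs_sub _ _).trans
    (add_le_add (abs_rademacherAverage_le hB hB0 σ (fun i => (z i).2) g)
      (abs_rademacherAverage_le hB hB0 σ (fun i => (z i).1) g))
  have hσi : ∀ σ : Fin n → Bool, Integrable (fun z : Fin n → X × X =>
      ⨆ g, ((∑ i, boolSign (σ i) * h g (z i).2) / n -
        (∑ i, boolSign (σ i) * h g (z i).1) / n)) Q := by
    intro σ
    refine integrable_of_abs_le (.iSup fun g => ?_) fun z => abs_ciSup_le (hσb σ z)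
    fun_prop
  have hpt : ∀ z : Fin n → X × X, 𝔼 σ : Fin n → Bool,
      ⨆ g, ((∑ i, boolSign (σ i) * h g (z i).2) / n -
        (∑ i, boolSign (σ i) * h g (z i).1) / n) ≤
      empiricalRademacher h (fun i => (z i).2) + empiricalRademacher h (fun i => (z i).1) := by
    intro z
    rw [← empiricalRademacher_neg h (fun i => (z i).1), empiricalRademacher, empiricalRademacher,
      ← Finset.expect_add_distrib]
    refine Finset.expect_le_expect fun σ _ => ciSup_le fun g => ?_
    have h1 := le_ciSup (bddAbove_range_of_abs_le
      (abs_rademacherAverage_le hB hB0 σ fun i => (z i).2)) g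
    have h2 := le_ciSup (bddAbove_range_of_abs_le
      (abs_rademacherAverage_le (h := fun g x => -h g x) (by simpa using hB) hB0 σ
        fun i => (z i).1)) g
    simp only [mul_neg, Finset.sum_neg_distrib, neg_div] at h2 ⊢
    linarith
  have hdev : Integrable (fun xs : Fin n → X =>
      ⨆ g, (∫ x, h g x ∂ρ - (∑ i, h g (xs i)) / n)) P := by
    refine integrable_of_abs_le (C := B + B) (.iSup fun g => by fun_prop) fun xs =>
      abs_ciSup_le fun g => (abs_sub _ _).trans
        (add_le_add (abs_integral_le_of_abs_le (hB g)) (abs_average_le (hB g) hB0 _))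
  calc ∫ xs, ⨆ g, (∫ x, h g x ∂ρ - (∑ i, h g (xs i)) / n) ∂P
      ≤ ∫ xs, ∫ ys, Φ xs ys ∂P ∂P :=
        integral_mono hdev (integrable_of_abs_le
          (hΦm.stronglyMeasurable.integral_prod_right' (ν := P)).measurable
          fun xs => abs_integral_le_of_abs_le (hΦB xs)) hghost
    _ = 𝔼 σ : Fin n → Bool, ∫ z, Φ (fun i => (z i).1) (fun i => (z i).2) ∂Q := by
        rw [Fintype.expect_const, hQint]
    _ = ∫ z, 𝔼 σ : Fin n → Bool, ⨆ g, ((∑ i, boolSign (σ i) * h g (z i).2) / n -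
        (∑ i, boolSign (σ i) * h g (z i).1) / n) ∂Q := by
        rw [Finset.expect_congr rfl fun σ _ => hswap σ]
        simp only [Fintype.expect_eq_sum_div_card]
        rw [integral_div, integral_finsetSum _ fun σ _ => hσi σ]
    _ ≤ ∫ z, (empiricalRademacher h (fun i => (z i).2) +
          empiricalRademacher h (fun i => (z i).1)) ∂Q := by
        refine integral_mono ?_ ((hsnd.integrable_comp_of_integrable hRi).add
          (hfst.integrable_comp_of_integrable hRi)) hpt
        simp only [Fintype.expect_eq_sum_div_card]
        exact (integrable_finsetSum _ fun σ _ => hσi σ).div_const _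
    _ = 2 * ∫ xs, empiricalRademacher h xs ∂P := by
        have h1 : ∫ z, empiricalRademacher h (fun i => (z i).1) ∂Q =
            ∫ xs, empiricalRademacher h xs ∂P := by
          rw [← hfst.map_eq, integral_map hfst.measurable.aemeasurable hRm.aestronglyMeasurable]
        have h2 : ∫ z, empiricalRademacher h (fun i => (z i).2) ∂Q =
            ∫ xs, empiricalRademacher h xs ∂P := by
          rw [← hsnd.map_eq, integral_map hsnd.measurable.aemeasurable hRm.aestronglyMeasurable]
        have hi1 : Integrable (fun z => empiricalRademacher h fun i => (z i).1) Q :=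
          hfst.integrable_comp_of_integrable hRi
        have hi2 : Integrable (fun z => empiricalRademacher h fun i => (z i).2) Q :=
          hsnd.integrable_comp_of_integrable hRi
        rw [integral_add hi2 hi1, h1, h2]
        ring

lemma measure_le_ciSup_sub_average_le (ρ : Measure X) [IsProbabilityMeasure ρ] {h : ι → X → ℝ}
    (hm : ∀ g, Measurable (h g)) {B s : ℝ} (hB : ∀ g x, |h g x| ≤ B)
    (hd : ∀ g x y, |h g x - h g y| ≤ B) (hn : 0 < n) (hs : 0 ≤ s) :
    (Measure.pi fun _ : Fin n => ρ).real
        {xs | 2 * ∫ ys, empiricalRademacher h ys ∂(Measure.pi fun _ : Fin n => ρ) + s ≤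
          ⨆ g, (∫ x, h g x ∂ρ - (∑ i, h g (xs i)) / n)} ≤
      Real.exp (-2 * n * s ^ 2 / B ^ 2) := by
  have hn' : (0 : ℝ) < n := by positivity
  have hB0 : 0 ≤ B := by
    obtain ⟨g⟩ := ‹Nonempty ι›
    obtain ⟨x⟩ := nonempty_of_isProbabilityMeasure ρ
    exact (abs_nonneg _).trans (hB g x)
  set f : (Fin n → X) → ℝ := fun xs => ⨆ g, (∫ x, h g x ∂ρ - (∑ i, h g (xs i)) / n) with hf
  have hb : ∀ (xs : Fin n → X) g, |∫ x, h g x ∂ρ - (∑ i, h g (xs i)) / n| ≤ B + B :=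
    fun xs g => (abs_sub _ _).trans
      (add_le_add (abs_integral_le_of_abs_le (hB g)) (abs_average_le (hB g) hB0 _))
  have hdiff : ∀ xs i x, |f (Function.update xs i x) - f xs| ≤ B / n := by
    intro xs i x
    refine abs_ciSup_sub_ciSup_le (hb _) (hb _) fun g => ?_
    rw [sub_sub_sub_cancel_left, ← sub_div, ← Finset.sum_sub_distrib,
      Finset.sum_eq_single i (fun j _ hj => by simp [hj]) (by simp), abs_div, Nat.abs_cast]
    exact div_le_div_of_nonneg_right (hd g _ _) hn'.le
  have hfm : Measurable f := .iSup fun g => by fun_prop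
  have hM := measure_ge_le_of_bounded_differences ρ hfm (fun xs => abs_ciSup_le (hb xs)) hdiff hs
  have hsym := integral_ciSup_sub_average_le ρ hm hB hn
  refine (measureReal_mono fun xs hxs => ?_).trans (hM.trans_eq ?_)
  · simp only [Set.mem_ofPred_eq] at hxs ⊢
    linarith
  · congr 1
    rw [div_pow, show (n : ℝ) * (B ^ 2 / n ^ 2) = B ^ 2 / n by field_simp,
      div_div_eq_mul_div]
    ring

/-- Uniform deviation bound for a bounded class in terms of its Rademacher complexity. -/
lemma le_measure_ciSup_abs_average_sub_le (ρ : Measure X) [IsProbabilityMeasure ρ]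
    {h : ι → X → ℝ} (hm : ∀ g, Measurable (h g)) {B δ : ℝ} (h0 : ∀ g x, 0 ≤ h g x)
    (hB : ∀ g x, h g x ≤ B) (hn : 0 < n) (hδ : δ ∈ Set.Ioo (0 : ℝ) 1) :
    ENNReal.ofReal (1 - δ) ≤ (Measure.pi fun _ : Fin n => ρ)
      {xs | ⨆ g, |(∑ i, h g (xs i)) / n - ∫ x, h g x ∂ρ| ≤
        2 * ∫ ys, empiricalRademacher h ys ∂(Measure.pi fun _ : Fin n => ρ) +
          B * √(Real.log (2 / δ) / (2 * n))} := by
  have hn' : (0 : ℝ) < n := by positivity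
  have hB0 : 0 ≤ B := by
    obtain ⟨g⟩ := ‹Nonempty ι›
    obtain ⟨x⟩ := nonempty_of_isProbabilityMeasure ρ
    exact (h0 g x).trans (hB g x)
  have habs : ∀ g x, |h g x| ≤ B := fun g x => by rw [abs_of_nonneg (h0 g x)]; exact hB g x
  set P : Measure (Fin n → X) := Measure.pi fun _ => ρ with hP
  set M : ℝ := ∫ ys, empiricalRademacher h ys ∂P with hM
  have hM0 : 0 ≤ M := integral_nonneg fun xs => empiricalRademacher_nonneg habs xs
  rcases hB0.eq_or_lt with rfl | hBpos
  · have hz : ∀ g x, h g x = 0 := fun g x => le_antisymm (hB g x) (h0 g x)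
    have : {xs : Fin n → X | ⨆ g, |(∑ i, h g (xs i)) / n - ∫ x, h g x ∂ρ| ≤
        2 * M + 0 * √(Real.log (2 / δ) / (2 * n))} = Set.univ :=
      Set.eq_univ_of_forall fun xs => by simp [hz, hM0]
    rw [this, measure_univ]
    exact ENNReal.ofReal_le_one.2 (by linarith [hδ.1])
  set s : ℝ := B * √(Real.log (2 / δ) / (2 * n)) with hs
  have hs0 : 0 ≤ s := by positivity
  have hlog : 0 ≤ Real.log (2 / δ) :=
    Real.log_nonneg ((one_le_div hδ.1).2 (by linarith [hδ.2]))
  have hexp : Real.exp (-2 * n * s ^ 2 / B ^ 2) = δ / 2 := by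
    have : -2 * n * s ^ 2 / B ^ 2 = Real.log (δ / 2) := by
      rw [hs, mul_pow, Real.sq_sqrt (by positivity), ← inv_div 2 δ, Real.log_inv]
      field_simp
    rw [this, Real.exp_log (by linarith [hδ.1])]
  have hd : ∀ g x y, |h g x - h g y| ≤ B := fun g x y =>
    abs_le.2 ⟨by linarith [h0 g x, hB g y], by linarith [h0 g y, hB g x]⟩
  have h1 := measure_le_ciSup_sub_average_le ρ hm habs hd hn hs0
  have h2 := measure_le_ciSup_sub_average_le ρ (h := fun g x => -h g x) (fun g => (hm g).neg)
    (by simpa using habs) (fun g x y => by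
      rw [neg_sub_neg]
      exact hd g y x) hn hs0
  simp only [empiricalRademacher_neg] at h2
  rw [hexp, ← hP, ← hM] at h1 h2
  set U : Set (Fin n → X) := {xs | 2 * M + s ≤ ⨆ g, (∫ x, h g x ∂ρ - (∑ i, h g (xs i)) / n)}
    with hU
  set V : Set (Fin n → X) :=
    {xs | 2 * M + s ≤ ⨆ g, (∫ x, -h g x ∂ρ - (∑ i, -h g (xs i)) / n)} with hV
  have hUV : MeasurableSet (U ∪ V) :=
    (measurableSet_le measurable_const (.iSup fun g => by fun_prop)).union
      (measurableSet_le measurable_const (.iSup fun g => by fun_prop))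
  have hle : P.real (U ∪ V) ≤ δ := (measureReal_union_le U V).trans (by linarith)
  have hbd : ∀ (xs : Fin n → X) g, |∫ x, h g x ∂ρ - (∑ i, h g (xs i)) / n| ≤ B + B :=
    fun xs g => (abs_sub _ _).trans
      (add_le_add (abs_integral_le_of_abs_le (habs g)) (abs_average_le (habs g) hB0 _))
  calc ENNReal.ofReal (1 - δ) ≤ ENNReal.ofReal (P.real (U ∪ V)ᶜ) := by
        rw [probReal_compl_eq_one_sub hUV]
        exact ENNReal.ofReal_le_ofReal (by linarith)
    _ = P (U ∪ V)ᶜ := ofReal_measureReal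
    _ ≤ _ := measure_mono fun xs hxs => ?_
  simp only [Set.compl_union, Set.mem_inter_iff, Set.mem_compl_iff, hU, hV, Set.mem_ofPred_eq,
    not_le, integral_neg, Finset.sum_neg_distrib, neg_div, sub_neg_eq_add] at hxs
  change ⨆ g, |(∑ i, h g (xs i)) / n - ∫ x, h g x ∂ρ| ≤ 2 * M + s
  refine ciSup_le fun g => abs_le.2 ⟨?_, ?_⟩
  · linarith [hxs.1, le_ciSup (bddAbove_range_of_abs_le (hbd xs)) g]
  · have hbd_neg : ∀ g, |-∫ x, h g x ∂ρ + (∑ i, h g (xs i)) / n| ≤ B + B := fun g => by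
      rw [← abs_neg]
      convert hbd xs g using 2
      ring
    linarith [hxs.2, le_ciSup (bddAbove_range_of_abs_le hbd_neg) g]

/-- Contraction of the Rademacher complexity under composition with Lipschitz functions of a
vector-valued class. -/
lemma integral_empiricalRademacher_le (ρ : Measure X) [IsProbabilityMeasure ρ] {K : ℕ}
    {h : ι → X → ℝ} {a : ι → X → EuclideanSpace ℝ (Fin K)} {B D L : ℝ}
    (hm : ∀ g, Measurable (h g)) (hB : ∀ g x, |h g x| ≤ B) (ham : ∀ g, Measurable (a g))
    (ha : ∀ g x k, |a g x k| ≤ D) (hL : 0 ≤ L)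
    (hlip : ∀ g g' x, |h g x - h g' x| ≤ L * ‖a g x - a g' x‖) :
    ∫ xs, empiricalRademacher h xs ∂(Measure.pi fun _ : Fin n => ρ) ≤
      √2 * L * ∑ k, ∫ xs, empiricalRademacher (fun g x => a g x k) xs
        ∂(Measure.pi fun _ : Fin n => ρ) := by
  obtain ⟨g₀⟩ := ‹Nonempty ι›
  obtain ⟨x₀⟩ := nonempty_of_isProbabilityMeasure ρ
  have hB0 : 0 ≤ B := (abs_nonneg _).trans (hB g₀ x₀)
  have hak : ∀ k g, Measurable fun x => a g x k := fun k g => by fun_prop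
  have hi : ∀ k, Integrable (empiricalRademacher fun g x => a g x k)
      (Measure.pi fun _ : Fin n => ρ) := fun k =>
    integrable_of_abs_le (measurable_empiricalRademacher (hak k))
      (abs_empiricalRademacher_le (fun g x => ha g x k) ((abs_nonneg _).trans (ha g₀ x₀ k)))
  rw [← integral_finsetSum _ fun k _ => hi k, ← integral_const_mul]
  refine integral_mono (integrable_of_abs_le (measurable_empiricalRademacher hm)
    (abs_empiricalRademacher_le hB hB0)) ((integrable_finsetSum _ fun k _ => hi k).const_mul _)
    fun xs => ?_
  have := expect_ciSup_vector_contraction (ψ := fun i g => h g (xs i)) (a := fun i g => a g (xs i))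
    hL (fun i g k => ha g (xs i) k) (fun i g g' => hlip g g' (xs i)) fun i g => hB g (xs i)
  simp only [empiricalRademacher_eq, ← Finset.mul_sum]
  calc _ ≤ (n : ℝ)⁻¹ * _ := mul_le_mul_of_nonneg_left this (by positivity)
    _ = _ := by ring

end Symmetrization

section ClassConditional

variable {X : Type*} [MeasurableSpace X]

lemma integral_smul_withDensity_ofReal (μ : Measure X) {p : X → ℝ} (hp : Measurable p)
    (hp0 : ∀ x, 0 ≤ p x) {c : ℝ} (hc : 0 < c) (f : X → ℝ) :
    ∫ x, f x ∂((ENNReal.ofReal c)⁻¹ • μ.withDensity fun x => ENNReal.ofReal (p x)) =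
      c⁻¹ * ∫ x, p x * f x ∂μ := by
  rw [integral_smul_measure, integral_withDensity_eq_integral_toReal_smul hp.ennreal_ofReal
    (.of_forall fun _ => ENNReal.ofReal_lt_top), ENNReal.toReal_inv, ENNReal.toReal_ofReal hc.le]
  simp [ENNReal.toReal_ofReal, hp0]

lemma isProbabilityMeasure_smul_withDensity_ofReal (μ : Measure X) {p : X → ℝ}
    (hp0 : ∀ x, 0 ≤ p x) (hpi : Integrable p μ) (hc : 0 < ∫ x, p x ∂μ) :
    IsProbabilityMeasure ((ENNReal.ofReal (∫ x, p x ∂μ))⁻¹ •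
      μ.withDensity fun x => ENNReal.ofReal (p x)) := by
  refine ⟨?_⟩
  rw [Measure.smul_apply, withDensity_apply _ .univ, Measure.restrict_univ,
    ← ofReal_integral_eq_lintegral_ofReal hpi (.of_forall hp0), smul_eq_mul,
    ENNReal.inv_mul_cancel (ENNReal.ofReal_pos.2 hc).ne' ENNReal.ofReal_ne_top]

lemma ae_pi_forall {n : ℕ} {ρ : Measure X} [IsProbabilityMeasure ρ] {q : X → Prop}
    (hq : ∀ᵐ x ∂ρ, q x) : ∀ᵐ xs ∂(Measure.pi fun _ : Fin n => ρ), ∀ i, q (xs i) :=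
  ae_all_iff.2 fun i => (measurePreserving_eval (fun _ => ρ) i).quasiMeasurePreserving.ae hq

lemma ContinuousOn.measurable_comp {E : Type*} [TopologicalSpace E] [MeasurableSpace E]
    [BorelSpace E] {s : Set E} {φ : E → ℝ} (hφ : ContinuousOn φ s) {g : X → E}
    (hg : Measurable g) (hgs : ∀ x, g x ∈ s) : Measurable fun x => φ (g x) :=
  (continuousOn_iff_continuous_domRestrict.1 hφ).measurable.comp (hg.subtype_mk (h := hgs))

lemma continuousOn_of_abs_sub_le {E : Type*} [SeminormedAddCommGroup E] {s : Set E} {φ : E → ℝ}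
    {L : ℝ} (h : ∀ u ∈ s, ∀ v ∈ s, |φ u - φ v| ≤ L * ‖u - v‖) : ContinuousOn φ s :=
  LipschitzOnWith.continuousOn (K := L.toNNReal) <| .of_dist_le_mul fun u hu v hv => by
    rw [Real.dist_eq, dist_eq_norm]
    exact (h u hu v hv).trans
      (mul_le_mul_of_nonneg_right (Real.le_coe_toNNReal L) (norm_nonneg _))

end ClassConditional

/-- **Uniform deviation bound for SC-Conf classification.**
With probability at least `1 − δ` over an i.i.d. sample of size `n` from the single-class
conditional distribution `ν = p(x|y_s)`,
`sup_{g ∈ G} |R̂_SC(g) − R(g)| ≤ (2√2 π L_ℓ / C_r) ∑_y Rad_n(G_y, ν)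
  + (π C_ℓ / C_r) √(log(2/δ)/(2n))`. -/
theorem sc_conf_uniform_deviation_bound
    {X : Type*} [MeasurableSpace X] (μ : Measure X) [IsProbabilityMeasure μ]
    {K : ℕ} (hK : 2 ≤ K) (r : Fin K → X → ℝ)
    (hrm : ∀ y, Measurable (r y)) (hr0 : ∀ y x, 0 ≤ r y x)
    (hr1 : ∀ x, ∑ y, r y x = 1)
    (ys : Fin K) (Cr : ℝ) (hCr : Cr ∈ Set.Ioc (0 : ℝ) 1)
    (hrC : ∀ᵐ x ∂μ, Cr ≤ r ys x)
    (π : ℝ) (hπ : π = ∫ x, r ys x ∂μ) (hπ0 : 0 < π)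
    (ν : Measure X)
    (hν : ν = (ENNReal.ofReal π)⁻¹ • μ.withDensity fun x => ENNReal.ofReal (r ys x))
    (G : Set (X → EuclideanSpace ℝ (Fin K))) (hGc : G.Countable) (hGne : G.Nonempty)
    (hGm : ∀ g ∈ G, Measurable g)
    (Cg : ℝ) (hGb : ∀ g ∈ G, ∀ x, ∀ y, |g x y| ≤ Cg)
    (ℓ : EuclideanSpace ℝ (Fin K) → Fin K → ℝ) (Cℓ Lℓ : ℝ)
    (hℓb : ∀ u : EuclideanSpace ℝ (Fin K), (∀ y, |u y| ≤ Cg) →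
      ∀ y, 0 ≤ ℓ u y ∧ ℓ u y ≤ Cℓ)
    (hℓL : ∀ u u' : EuclideanSpace ℝ (Fin K), (∀ y, |u y| ≤ Cg) → (∀ y, |u' y| ≤ Cg) →
      ∀ y, |ℓ u y - ℓ u' y| ≤ Lℓ * ‖u - u'‖)
    (n : ℕ) (hn : 1 ≤ n) (δ : ℝ) (hδ : δ ∈ Set.Ioo (0 : ℝ) 1) :
    ENNReal.ofReal (1 - δ) ≤
      (Measure.pi fun _ : Fin n => ν)
        {xs | sSup ((fun g =>
              |π / n * ∑ i, ∑ y, r y (xs i) / r ys (xs i) * ℓ (g (xs i)) y -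
                ∫ x, ∑ y, r y x * ℓ (g x) y ∂μ|) '' G) ≤
          2 * Real.sqrt 2 * π * Lℓ / Cr *
              ∑ y, rademacherComplexity ν n ((fun g x => g x y) '' G) +
            π * Cℓ / Cr * Real.sqrt (Real.log (2 / δ) / (2 * n))} := by
  have : Countable G := hGc.to_subtype
  have : Nonempty G := hGne.to_subtype
  obtain ⟨g₀, hg₀⟩ := hGne
  obtain ⟨x₀⟩ := nonempty_of_isProbabilityMeasure μ
  have hCr0 : 0 < Cr := hCr.1
  have hri : Integrable (r ys) μ := integrable_of_abs_le (C := 1) (hrm ys) fun x => by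
    rw [abs_of_nonneg (hr0 ys x), ← hr1 x]
    exact Finset.single_le_sum (fun y _ => hr0 y x) (Finset.mem_univ ys)
  have hνp : IsProbabilityMeasure ν := by
    rw [hν, hπ]
    exact isProbabilityMeasure_smul_withDensity_ofReal μ (hr0 ys) hri (hπ ▸ hπ0)
  have hνC : ∀ᵐ x ∂ν, Cr ≤ r ys x := by
    rw [hν]
    exact Measure.ae_smul_measure ((withDensity_absolutelyContinuous _ _).ae_le hrC) _
  have hCℓ0 : 0 ≤ Cℓ := (hℓb _ (hGb g₀ hg₀ x₀) ys).1.trans (hℓb _ (hGb g₀ hg₀ x₀) ys).2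
  set w : Fin K → X → ℝ := fun y x => if Cr ≤ r ys x then π * r y x / r ys x else 0 with hw
  have hwm : ∀ y, Measurable (w y) := fun y =>
    .ite (measurableSet_le measurable_const (hrm ys))
      (((hrm y).const_mul π).div (hrm ys)) measurable_const
  have hw0 : ∀ y x, 0 ≤ w y x := fun y x => by
    simp only [hw]
    split_ifs
    · exact div_nonneg (mul_nonneg hπ0.le (hr0 y x)) (hr0 ys x)
    · exact le_rfl
  have hwsum : ∀ x, ∑ y, w y x ≤ π / Cr := fun x => by
    simp only [hw]
    split_ifs with hx
    · rw [← Finset.sum_div, ← Finset.mul_sum, hr1, mul_one]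
      exact div_le_div_of_nonneg_left hπ0.le hCr0 hx
    · simp only [Finset.sum_const_zero]
      positivity
  set h : G → X → ℝ := fun g x => ∑ y, w y x * ℓ (g.1 x) y with hh
  have hm : ∀ g, Measurable (h g) := fun g => by
    refine Finset.measurable_sum _ fun y _ => (hwm y).mul ?_
    exact (continuousOn_of_abs_sub_le (s := {u : EuclideanSpace ℝ (Fin K) | ∀ y, |u y| ≤ Cg})
      (φ := fun u => ℓ u y) fun u hu v hv => hℓL u v hu hv y).measurable_comp (hGm g g.2)
      (hGb g g.2)
  have h0 : ∀ g x, 0 ≤ h g x := fun g x => Finset.sum_nonneg fun y _ =>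
    mul_nonneg (hw0 y x) (hℓb _ (hGb g g.2 x) y).1
  have hB : ∀ g x, h g x ≤ π * Cℓ / Cr := fun g x => by
    calc h g x ≤ ∑ y, w y x * Cℓ := Finset.sum_le_sum fun y _ =>
          mul_le_mul_of_nonneg_left (hℓb _ (hGb g g.2 x) y).2 (hw0 y x)
      _ = (∑ y, w y x) * Cℓ := (Finset.sum_mul ..).symm
      _ ≤ π / Cr * Cℓ := mul_le_mul_of_nonneg_right (hwsum x) hCℓ0
      _ = _ := by ring
  have hlip : ∀ g g' x, |h g x - h g' x| ≤ π / Cr * max Lℓ 0 * ‖g.1 x - g'.1 x‖ := by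
    intro g g' x
    calc |h g x - h g' x| = |∑ y, w y x * (ℓ (g.1 x) y - ℓ (g'.1 x) y)| := by
          simp only [hh, mul_sub, Finset.sum_sub_distrib]
      _ ≤ ∑ y, w y x * (max Lℓ 0 * ‖g.1 x - g'.1 x‖) := by
          refine (Finset.abs_sum_le_sum_abs _ _).trans (Finset.sum_le_sum fun y _ => ?_)
          rw [abs_mul, abs_of_nonneg (hw0 y x)]
          exact mul_le_mul_of_nonneg_left ((hℓL _ _ (hGb g g.2 x) (hGb g' g'.2 x) y).trans
            (mul_le_mul_of_nonneg_right (le_max_left _ _) (norm_nonneg _))) (hw0 y x)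
      _ = (∑ y, w y x) * (max Lℓ 0 * ‖g.1 x - g'.1 x‖) := (Finset.sum_mul ..).symm
      _ ≤ π / Cr * (max Lℓ 0 * ‖g.1 x - g'.1 x‖) :=
          mul_le_mul_of_nonneg_right (hwsum x) (by positivity)
      _ = _ := (mul_assoc ..).symm
  have hrisk : ∀ g : G, ∫ x, h g x ∂ν = ∫ x, ∑ y, r y x * ℓ (g.1 x) y ∂μ := fun g => by
    rw [hν, integral_smul_withDensity_ofReal μ (hrm ys) (hr0 ys) hπ0, ← integral_const_mul]
    refine integral_congr_ae (hrC.mono fun x hx => ?_)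
    have hx0 : r ys x ≠ 0 := (hCr0.trans_le hx).ne'
    simp only [hh, hw, if_pos hx, Finset.mul_sum]
    refine Finset.sum_congr rfl fun y _ => ?_
    field_simp
  have hcoord : ∀ y, rademacherComplexity ν n ((fun g x => g x y) '' G) =
      ∫ xs, empiricalRademacher (fun (g : G) x => g.1 x y) xs
        ∂(Measure.pi fun _ : Fin n => ν) := fun y => by
    rw [Set.image_eq_range, rademacherComplexity_range]
  have hLℓ : max Lℓ 0 * ∑ y, rademacherComplexity ν n ((fun g x => g x y) '' G) =
      Lℓ * ∑ y, rademacherComplexity ν n ((fun g x => g x y) '' G) := by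
    rcases le_or_gt 0 Lℓ with hL | hL
    · rw [max_eq_left hL]
    have hzero : ∀ (g : G) x, g.1 x = 0 := fun g x => by
      have hle := (abs_nonneg _).trans (hℓL (g.1 x) (-g.1 x) (hGb g g.2 x)
        (fun y => by simpa using hGb g g.2 x y) ys)
      have : ‖g.1 x - -g.1 x‖ = 0 := by nlinarith [norm_nonneg (g.1 x - -g.1 x)]
      simpa [sub_neg_eq_add, ← two_smul ℝ] using this
    have : ∑ y, rademacherComplexity ν n ((fun g x => g x y) '' G) = 0 :=
      Finset.sum_eq_zero fun y _ => by
        rw [hcoord]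
        simp [hzero, empiricalRademacher]
    rw [this, mul_zero, mul_zero]
  have hcontr := integral_empiricalRademacher_le (n := n) ν (h := h) (a := fun g => g.1) hm
    (fun g x => by rw [abs_of_nonneg (h0 g x)]; exact hB g x) (fun g => hGm g g.2)
    (fun g => hGb g g.2) (L := π / Cr * max Lℓ 0) (by positivity) hlip
  simp only [← hcoord] at hcontr
  refine (le_measure_ciSup_abs_average_sub_le ν hm h0 hB hn hδ).trans (measure_mono_ae ?_)
  filter_upwards [ae_pi_forall hνC] with xs hxs hle
  have hemp : ∀ g : G, π / n * ∑ i, ∑ y, r y (xs i) / r ys (xs i) * ℓ (g.1 (xs i)) y =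
      (∑ i, h g (xs i)) / n := fun g => by
    simp only [hh, hw, if_pos (hxs _), Finset.mul_sum, Finset.sum_div]
    exact Finset.sum_congr rfl fun i _ => Finset.sum_congr rfl fun y _ => by ring
  change ⨆ g, |(∑ i, h g (xs i)) / n - ∫ x, h g x ∂ν| ≤ _ at hle
  change sSup _ ≤ _
  rw [sSup_image']
  simp only [hemp, ← hrisk]
  refine hle.trans (add_le_add_left ?_ _)
  calc _ ≤ 2 * (√2 * (π / Cr * max Lℓ 0) *
        ∑ y, rademacherComplexity ν n ((fun g x => g x y) '' G)) := by gcongr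
    _ = 2 * √2 * π / Cr * (max Lℓ 0 *
        ∑ y, rademacherComplexity ν n ((fun g x => g x y) '' G)) := by ring
    _ = _ := by
        rw [hLℓ]
        ring
end
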